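/- Let T > 0, L ≥ 0 and let h : [0,T] → ℝ be an L-Lipschitz function. Then sup_{t ∈ [0,T]} |h(t)| ≤ max( √(2L · ∫₀ᵀ |h(t)| dt), (4/T) · ∫₀ᵀ |h(t)| dt ). -/

import Mathlib

open MeasureTheory

/-- If `|h|` dominates an affine function on `[a, a + d] ⊆ [0, T]`, then its integral over `[0, T]`
dominates the integral of the affine function over `[a, a + d]`. -/
lemma integral_affine_le_setIntegral_abs {T a d p q : ℝ} {h : ℝ → ℝ}
    (hint : IntegrableOn (fun s => |h s|) (Set.Icc 0 T)) (ha : 0 ≤ a) (hd : 0 ≤ d)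
    (had : a + d ≤ T) (hle : ∀ s ∈ Set.Icc a (a + d), p + q * (s - a) ≤ |h s|) :
    p * d + q * d ^ 2 / 2 ≤ ∫ s in Set.Icc (0 : ℝ) T, |h s| := by
  have hsub : Set.Icc a (a + d) ⊆ Set.Icc 0 T := Set.Icc_subset_Icc ha had
  calc p * d + q * d ^ 2 / 2 = ∫ s in a..(a + d), (p + q * (s - a)) := by
        rw [intervalIntegral.integral_comp_sub_right (fun x => p + q * x),
          intervalIntegral.integral_add (by simp)
            (Continuous.intervalIntegrable (by fun_prop) _ _),
          intervalIntegral.integral_const, intervalIntegral.integral_const_mul, integral_id,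
          smul_eq_mul]
        ring
    _ = ∫ s in Set.Icc a (a + d), (p + q * (s - a)) := by
        rw [intervalIntegral.integral_of_le (by linarith), integral_Icc_eq_integral_Ioc]
    _ ≤ ∫ s in Set.Icc a (a + d), |h s| :=
        setIntegral_mono_on (Continuous.integrableOn_Icc (by fun_prop)) (hint.mono_set hsub)
          measurableSet_Icc hle
    _ ≤ ∫ s in Set.Icc 0 T, |h s| :=
        setIntegral_mono_set hint (Filter.Eventually.of_forall fun s => abs_nonneg (h s))
          hsub.eventuallyLE

/-- For an `L`-Lipschitz function `h` on `[0,T]`, the sup of `|h|` over `[0,T]` is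
bounded by `max (√(2L·∫₀ᵀ|h|)) ((4/T)·∫₀ᵀ|h|)`. -/
theorem lipschitz_sup_le_max_sqrt_integral (T L : ℝ) (hT : 0 < T) (hL : 0 ≤ L)
    (h : ℝ → ℝ)
    (hlip : ∀ s ∈ Set.Icc (0 : ℝ) T, ∀ t ∈ Set.Icc (0 : ℝ) T,
      |h s - h t| ≤ L * |s - t|) :
    ∀ t ∈ Set.Icc (0 : ℝ) T,
      |h t| ≤ max (Real.sqrt (2 * L * ∫ s in Set.Icc (0 : ℝ) T, |h s|))
        ((4 / T) * ∫ s in Set.Icc (0 : ℝ) T, |h s|) := by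
  intro t ht
  have hcont : ContinuousOn h (Set.Icc 0 T) :=
    (LipschitzOnWith.of_dist_le_mul (K := ⟨L, hL⟩) fun s hs t ht => hlip s hs t ht).continuousOn
  have hint : IntegrableOn (fun s => |h s|) (Set.Icc 0 T) := hcont.abs.integrableOn_Icc
  have hlow : ∀ s ∈ Set.Icc 0 T, |h t| - L * |t - s| ≤ |h s| := fun s hs => by
    linarith [hlip t ht s hs, abs_sub_abs_le_abs_sub (h t) (h s)]
  have key : ∀ d, 0 ≤ d → d ≤ T / 2 →
      |h t| * d - L * d ^ 2 / 2 ≤ ∫ s in Set.Icc (0 : ℝ) T, |h s| := by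
    intro d hd hdT
    obtain ⟨ht0, htT⟩ := ht
    rcases le_total t (T / 2) with htm | htm
    · have := integral_affine_le_setIntegral_abs (p := |h t|) (q := -L) hint ht0 hd (by linarith)
        fun s hs => by
          have := hlow s ⟨ht0.trans hs.1, by linarith [hs.2]⟩
          rw [abs_of_nonpos (sub_nonpos.2 hs.1)] at this
          linarith
      linarith
    · have := integral_affine_le_setIntegral_abs (a := t - d) (p := |h t| - L * d) (q := L) hint
        (by linarith) hd (by linarith) fun s hs => by
          have := hlow s ⟨by linarith [hs.1], by linarith [hs.2]⟩
          rw [abs_of_nonneg (a := t - s) (by linarith [hs.2])] at this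
          linarith
      linarith
  rcases le_or_gt (L * (T / 2)) |h t| with hcase | hcase
  · refine le_max_of_le_right ?_
    have := key (T / 2) (by positivity) le_rfl
    rw [div_mul_eq_mul_div, le_div_iff₀ hT]
    nlinarith
  · refine le_max_of_le_left (Real.le_sqrt_of_sq_le ?_)
    have hL0 : 0 < L := hL.lt_of_ne fun h0 => by
      rw [← h0, zero_mul] at hcase
      exact hcase.not_ge (abs_nonneg _)
    have := key (|h t| / L) (by positivity) (by rw [div_le_iff₀ hL0]; linarith)
    calc |h t| ^ 2 = 2 * L * (|h t| * (|h t| / L) - L * (|h t| / L) ^ 2 / 2) := by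
          field_simp
          ring
      _ ≤ _ := by gcongr
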